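/- arXiv:2507.08646 — 2 statements merged into one kernel-verified Lean document; each statement's English description precedes it below -/
import Mathlib

section
/- Let h ≥ 2 be an integer, let i0 be an integer with 1 ≤ i0 ≤ h−1, let c = (h+1−i0)(h+1), let B = {0, 1, h+1} ⊆ ℤ, and for 0 ≤ i ≤ h let L_i = (h−i)B + ic. Then for all integers i and t with 0 ≤ i ≤ h−1 and 1 ≤ t ≤ h−i, L_i ∩ L_{i+t} = ⋃_{j=0}^{h−i−t−(h−i0)t} ((h + (h−i0)i − j)(h+1) + [0, j]), where the union is empty if h−i−t−(h−i0)t < 0 and [0, j] denotes the integer interval {0, 1, …, j}. -/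
open Pointwise

/-- The `h`-fold sumset of a finite set of integers: `hsum 0 A = {0}`,
`hsum (n+1) A = A + hsum n A`. -/
def hsum : ℕ → Finset ℤ → Finset ℤ
  | 0, _ => {0}
  | n + 1, A => A + hsum n A

/-- The `n`-fold sumset of `{0, 1, m}` consists of the `a * m + b` with `a, b ≥ 0`, `a + b ≤ n`. -/
theorem mem_hsum_zero_one_iff (m : ℤ) (n : ℕ) (x : ℤ) :
    x ∈ hsum n {0, 1, m} ↔ ∃ a b : ℤ, 0 ≤ a ∧ 0 ≤ b ∧ a + b ≤ n ∧ x = a * m + b := by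
  induction n generalizing x with
  | zero =>
    simp only [hsum, Finset.mem_singleton]
    constructor
    · rintro rfl
      exact ⟨0, 0, by simp⟩
    · rintro ⟨a, b, ha, hb, hab, rfl⟩
      obtain rfl : a = 0 := by push_cast at hab; omega
      obtain rfl : b = 0 := by push_cast at hab; omega
      simp
  | succ n ih =>
    simp only [hsum, Finset.mem_add, ih, Finset.mem_insert, Finset.mem_singleton]
    constructor
    · rintro ⟨y, hy, z, ⟨a, b, ha, hb, hab, rfl⟩, rfl⟩
      push_cast
      rcases hy with rfl | rfl | rfl
      · exact ⟨a, b, ha, hb, by omega, by ring⟩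
      · exact ⟨a, b + 1, ha, by omega, by omega, by ring⟩
      · exact ⟨a + 1, b, by omega, hb, by omega, by ring⟩
    · rintro ⟨a, b, ha, hb, hab, rfl⟩
      push_cast at hab
      by_cases ha' : a = 0
      · by_cases hb' : b = 0
        · exact ⟨0, by simp, 0, ⟨0, 0, by simp⟩, by simp [ha', hb']⟩
        · exact ⟨1, by simp, a * m + (b - 1), ⟨a, b - 1, ha, by omega, by omega, rfl⟩, by ring⟩
      · exact ⟨m, by simp, (a - 1) * m + b, ⟨a - 1, b, by omega, hb, by omega, rfl⟩, by ring⟩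

/-- Quotients and remainders modulo `m` are unique. -/
theorem eq_and_eq_of_mul_add_eq_mul_add {m q r q' r' : ℤ} (hr : 0 ≤ r) (hrm : r < m)
    (hr' : 0 ≤ r') (hrm' : r' < m) (heq : q * m + r = q' * m + r') : q = q' ∧ r = r' := by
  have hq : q = q' := by
    rcases lt_trichotomy q q' with hlt | hqq | hlt
    · nlinarith
    · exact hqq
    · nlinarith
  subst hq
  exact ⟨rfl, by linarith⟩

theorem stmt_15 (h : ℕ) (hh : 2 ≤ h) (i0 : ℕ) (hi0l : 1 ≤ i0) (hi0u : i0 ≤ h - 1)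
    (c : ℤ) (hc : c = ((h : ℤ) + 1 - (i0 : ℤ)) * ((h : ℤ) + 1))
    (B : Finset ℤ) (hB : B = {0, 1, (h : ℤ) + 1})
    (L : ℕ → Finset ℤ)
    (hL : ∀ i, L i = (hsum (h - i) B).image (fun x => x + (i : ℤ) * c)) :
    ∀ i t : ℕ, i ≤ h - 1 → 1 ≤ t → t ≤ h - i →
      L i ∩ L (i + t) =
        (Finset.Icc (0 : ℤ)
            ((h : ℤ) - (i : ℤ) - (t : ℤ) - ((h : ℤ) - (i0 : ℤ)) * (t : ℤ))).biUnion
          (fun j => Finset.Icc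
            (((h : ℤ) + ((h : ℤ) - (i0 : ℤ)) * (i : ℤ) - j) * ((h : ℤ) + 1))
            (((h : ℤ) + ((h : ℤ) - (i0 : ℤ)) * (i : ℤ) - j) * ((h : ℤ) + 1) + j)) := by
  intro i t hi ht hti
  have hmem : ∀ s : ℕ, s ≤ h → ∀ x : ℤ, x ∈ L s ↔ ∃ q b : ℤ,
      (s : ℤ) * ((h : ℤ) + 1 - i0) ≤ q ∧ 0 ≤ b ∧ q + b ≤ h + ((h : ℤ) - i0) * s ∧
        x = q * ((h : ℤ) + 1) + b := by
    intro s hs x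
    simp only [hL, hB, Finset.mem_image, mem_hsum_zero_one_iff, hc, Nat.cast_sub hs]
    constructor
    · rintro ⟨_, ⟨a, b, ha, hb, hab, rfl⟩, rfl⟩
      exact ⟨a + s * ((h : ℤ) + 1 - i0), b, by linarith, hb, by linarith, by ring⟩
    · rintro ⟨q, b, hq, hb, hqb, rfl⟩
      exact ⟨_, ⟨q - s * ((h : ℤ) + 1 - i0), b, by linarith, hb, by linarith, rfl⟩, by ring⟩
  have hk : (0 : ℤ) ≤ (h : ℤ) - i0 := by omega
  have hkt : 0 ≤ ((h : ℤ) - i0) * t := by positivity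
  ext x
  simp only [Finset.mem_inter, hmem i (by omega), hmem (i + t) (by omega), Finset.mem_biUnion,
    Finset.mem_Icc, Nat.cast_add]
  constructor
  · rintro ⟨⟨q, b, hq, hb, hqb, rfl⟩, q', b', hq', hb', hqb', heq⟩
    obtain ⟨rfl, rfl⟩ := eq_and_eq_of_mul_add_eq_mul_add hb (by linarith) hb' (by linarith) heq
    have hj : (h : ℤ) + ((h : ℤ) - i0) * i - (h + ((h : ℤ) - i0) * i - q) = q := by ring
    refine ⟨h + ((h : ℤ) - i0) * i - q, ⟨by linarith, by linarith⟩, ?_⟩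
    rw [hj]
    exact ⟨by linarith, by linarith⟩
  · rintro ⟨j, ⟨hj, hjt⟩, hlo, hup⟩
    have hx (y : ℤ) : x = y + (x - y) := by ring
    exact ⟨⟨_, _, by linarith, sub_nonneg.2 hlo, by linarith, hx _⟩,
      ⟨_, _, by linarith, sub_nonneg.2 hlo, by linarith, hx _⟩⟩
end

section
/- Let h ≥ 2 be an integer, let i0 be an integer with 1 ≤ i0 ≤ h−1, let c = (h+1−i0)(h+1), let B = {0, 1, h+1} ⊆ ℤ, and for 0 ≤ i ≤ h let L_i = (h−i)B + ic. Then |⋃_{i=0}^{i0} L_i| = Σ_{i=0}^{i0} C(h−i+2, 2) − Σ_{i=0}^{i0} C(i0+1−i, 2). -/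
open Pointwise

/-- Membership in the `n`-fold sumset of `{0, 1, q}`. -/
theorem mem_hsum_zero_one (q : ℤ) (n : ℕ) (x : ℤ) :
    x ∈ hsum n {0, 1, q} ↔ ∃ u v : ℕ, u + v ≤ n ∧ x = u + q * v := by
  induction n generalizing x with
  | zero =>
    simp only [hsum, Finset.mem_singleton]
    constructor
    · rintro rfl
      exact ⟨0, 0, by simp⟩
    · rintro ⟨u, v, huv, rfl⟩
      obtain ⟨rfl, rfl⟩ : u = 0 ∧ v = 0 := by omega
      simp
  | succ n ih =>
    simp only [hsum, Finset.mem_add, ih, Finset.mem_insert, Finset.mem_singleton]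
    constructor
    · rintro ⟨a, rfl | rfl | rfl, _, ⟨u, v, huv, rfl⟩, rfl⟩
      · exact ⟨u, v, by omega, by ring⟩
      · exact ⟨u + 1, v, by omega, by push_cast; ring⟩
      · exact ⟨u, v + 1, by omega, by push_cast; ring⟩
    · rintro ⟨u, v, huv, rfl⟩
      rcases u with _ | u
      · rcases v with _ | v
        · exact ⟨0, by simp, 0, ⟨0, 0, by simp⟩, by simp⟩
        · exact ⟨q, by simp, _, ⟨0, v, by omega, rfl⟩, by push_cast; ring⟩
      · exact ⟨1, by simp, _, ⟨u, v, by omega, rfl⟩, by push_cast; ring⟩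

/-- The lattice points `(u, v)` of the triangle `u + v ≤ n`. -/
def latticeTriangle (n : ℕ) : Finset (ℕ × ℕ) :=
  (Finset.range (n + 1)).biUnion Finset.HasAntidiagonal.antidiagonal

theorem mem_latticeTriangle {n : ℕ} {p : ℕ × ℕ} :
    p ∈ latticeTriangle n ↔ p.1 + p.2 ≤ n := by
  simp [latticeTriangle]

theorem card_latticeTriangle (n : ℕ) : (latticeTriangle n).card = (n + 2).choose 2 := by
  rw [latticeTriangle, Finset.card_biUnion]
  · simp only [Finset.Nat.card_antidiagonal]
    induction n with
    | zero => rfl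
    | succ n ih =>
      rw [Finset.sum_range_succ, ih, Nat.choose_succ_succ' (n + 2) 1, Nat.choose_one_right]
      ring
  · intro i _ j _ hij
    rw [Function.onFun, Finset.disjoint_left]
    intro p hp hq
    rw [Finset.HasAntidiagonal.mem_antidiagonal] at hp hq
    exact hij (hp.symm.trans hq)

/-- Uniqueness of the base `h + 1` representation. -/
theorem eq_of_add_mul_eq {h u u' : ℕ} {w w' : ℤ} (hu : u ≤ h) (hu' : u' ≤ h)
    (e : (u : ℤ) + (h + 1) * w = u' + (h + 1) * w') : u = u' ∧ w = w' := by
  have hw : w = w' := by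
    rcases lt_trichotomy w w' with hlt | heq | hgt
    · nlinarith
    · exact heq
    · nlinarith
  subst hw
  exact ⟨by omega, rfl⟩

/-- The image of the triangle of size `n` under `(u, v) ↦ u + (h + 1) (v + s)`. -/
def triangleImage (h : ℕ) (s : ℤ) (n : ℕ) : Finset ℤ :=
  (latticeTriangle n).image fun p => (p.1 : ℤ) + (h + 1) * (p.2 + s)

theorem mem_triangleImage {h : ℕ} {s : ℤ} {n : ℕ} {x : ℤ} :
    x ∈ triangleImage h s n ↔
      ∃ u v : ℕ, u + v ≤ n ∧ x = (u : ℤ) + (h + 1) * (v + s) := by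
  simp [triangleImage, mem_latticeTriangle, eq_comm]

theorem card_triangleImage {h : ℕ} (s : ℤ) {n : ℕ} (hn : n ≤ h) :
    (triangleImage h s n).card = (n + 2).choose 2 := by
  rw [triangleImage, Finset.card_image_of_injOn, card_latticeTriangle]
  rintro ⟨u, v⟩ hp ⟨u', v'⟩ hq e
  simp only [Finset.mem_coe, mem_latticeTriangle] at hp hq
  obtain ⟨h1, h2⟩ := eq_of_add_mul_eq (by omega) (by omega) e
  ext
  · exact h1
  · exact_mod_cast add_right_cancel h2

theorem hsum_image_eq_triangleImage (h n : ℕ) (s : ℤ) :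
    (hsum n {0, 1, (h : ℤ) + 1}).image (fun x => x + (h + 1) * s) = triangleImage h s n := by
  ext x
  simp only [Finset.mem_image, mem_hsum_zero_one, mem_triangleImage]
  constructor
  · rintro ⟨_, ⟨u, v, huv, rfl⟩, rfl⟩
    exact ⟨u, v, huv, by ring⟩
  · rintro ⟨u, v, huv, rfl⟩
    exact ⟨_, ⟨u, v, huv, rfl⟩, by ring⟩

/-- The part of a translated triangle already covered by the preceding ones is a triangle. -/
theorem triangleImage_inter_biUnion {h i0 k : ℕ} (hi0 : i0 ≤ h) (hk : k < i0) :
    triangleImage h ((k + 1 : ℕ) * ((h : ℤ) + 1 - i0)) (h - (k + 1)) ∩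
        (Finset.range (k + 1)).biUnion
          (fun i => triangleImage h (i * ((h : ℤ) + 1 - i0)) (h - i)) =
      triangleImage h ((k + 1 : ℕ) * ((h : ℤ) + 1 - i0)) (i0 - 1 - k) := by
  ext x
  simp only [Finset.mem_inter, Finset.mem_biUnion, mem_triangleImage, Finset.mem_range]
  constructor
  · rintro ⟨⟨u, v, huv, rfl⟩, j, hj, u', v', huv', e⟩
    obtain ⟨rfl, h2⟩ := eq_of_add_mul_eq (by omega) (by omega) e
    refine ⟨u, v, ?_, rfl⟩
    obtain ⟨d, rfl⟩ : ∃ d, k = j + d := ⟨k - j, by omega⟩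
    obtain ⟨m, rfl⟩ : ∃ m, h = i0 + m := ⟨h - i0, by omega⟩
    have hd : 0 ≤ (d : ℤ) * m := by positivity
    have h3 : (v' : ℤ) = v + d * m + d + m + 1 := by
      push_cast at h2
      linarith
    zify at huv' ⊢
    omega
  · rintro ⟨u, v, huv, rfl⟩
    refine ⟨⟨u, v, by omega, rfl⟩, k, by omega, u, v + (h + 1 - i0), by omega, ?_⟩
    push_cast [Nat.cast_sub (show i0 ≤ h + 1 by omega)]
    ring

theorem card_biUnion_triangleImage {h i0 k : ℕ} (hi0 : i0 ≤ h) (hk : k ≤ i0) :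
    ((Finset.range (k + 1)).biUnion
        (fun i => triangleImage h (i * ((h : ℤ) + 1 - i0)) (h - i))).card +
      ∑ i ∈ Finset.range k, (i0 + 1 - i).choose 2 =
    ∑ i ∈ Finset.range (k + 1), (h - i + 2).choose 2 := by
  induction k with
  | zero => simp [card_triangleImage]
  | succ k ih =>
    have ih := ih (by omega)
    have hinter := congrArg Finset.card (triangleImage_inter_biUnion hi0 (k := k) (by omega))
    rw [card_triangleImage _ (by omega), show i0 - 1 - k + 2 = i0 + 1 - k by omega] at hinter
    have hcard := Finset.card_union_add_card_inter
      (triangleImage h ((k + 1 : ℕ) * ((h : ℤ) + 1 - i0)) (h - (k + 1)))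
      ((Finset.range (k + 1)).biUnion
          (fun i => triangleImage h (i * ((h : ℤ) + 1 - i0)) (h - i)))
    rw [hinter, card_triangleImage _ (by omega)] at hcard
    rw [Finset.sum_range_succ _ (k + 1), Finset.sum_range_succ _ k,
      Finset.range_add_one (n := k + 1), Finset.biUnion_insert]
    omega

theorem stmt_18 (h : ℕ) (hh : 2 ≤ h) (i0 : ℕ) (hi0l : 1 ≤ i0) (hi0u : i0 ≤ h - 1)
    (c : ℤ) (hc : c = ((h : ℤ) + 1 - (i0 : ℤ)) * ((h : ℤ) + 1))
    (B : Finset ℤ) (hB : B = {0, 1, (h : ℤ) + 1})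
    (L : ℕ → Finset ℤ)
    (hL : ∀ i, L i = (hsum (h - i) B).image (fun x => x + (i : ℤ) * c)) :
    ((Finset.Icc 0 i0).biUnion L).card =
      ∑ i ∈ Finset.Icc 0 i0, Nat.choose (h - i + 2) 2 -
        ∑ i ∈ Finset.Icc 0 i0, Nat.choose (i0 + 1 - i) 2 := by
  have hL' : L = fun i : ℕ => triangleImage h (i * ((h : ℤ) + 1 - i0)) (h - i) := by
    funext i
    rw [hL, hB, hc, ← hsum_image_eq_triangleImage]
    congr 1
    funext x
    ring
  have hIcc : Finset.Icc 0 i0 = Finset.range (i0 + 1) := by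
    ext
    simp
  have hlast : ∑ i ∈ Finset.range (i0 + 1), (i0 + 1 - i).choose 2 =
      ∑ i ∈ Finset.range i0, (i0 + 1 - i).choose 2 := by
    simp [Finset.sum_range_succ]
  rw [hIcc, hlast, hL', ← card_biUnion_triangleImage (show i0 ≤ h by omega) le_rfl,
    Nat.add_sub_cancel]
end
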